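/- Let X and E be disjoint alphabets and let l, m ≥ 1 be integers. Let λ_{l,m} := (m, m, …, m) be the partition with l parts all equal to m. Then S_{λ_{l,m}}(E−X) = Σ_{λ ∈ Λ_{l,m}} (−1)^{|λ|} S_{λ'}(X) · S_{λ^c}(E), where for λ = (λ_1 ≥ … ≥ λ_l) ∈ Λ_{l,m}, |λ| = λ_1+…+λ_l, λ' ∈ Λ_{m,l} is the conjugate (transpose) partition, and λ^c := (m−λ_l ≥ … ≥ m−λ_1) ∈ Λ_{l,m} is the complement of λ in the l×m rectangle. -/

import Mathlib

/-!
Statement 6: For disjoint alphabets E and X and integers `l, m ≥ 1`, with `λ_{l,m}` the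
`l × m` rectangular partition,
`S_{λ_{l,m}}(E−X) = Σ_{λ ∈ Λ_{l,m}} (−1)^{|λ|} S_{λ'}(X) S_{λᶜ}(E)`,
where `λ'` is the conjugate partition and `λᶜ` the complement in the `l × m` rectangle.
Partitions in `Λ_{l,m}` are encoded as antitone functions `Fin l → Fin (m+1)`.
-/

open MvPolynomial

/-- The `j`-th elementary symmetric polynomial in the variables of the finset `A`. -/
noncomputable def esymmF {σ : Type*} [DecidableEq σ] (A : Finset σ) (j : ℕ) :
    MvPolynomial σ ℂ :=
  ∑ s ∈ A.powersetCard j, ∏ i ∈ s, X i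

/-- The `j`-th complete homogeneous symmetric polynomial in the variables of the finset `A`. -/
noncomputable def hsymmF {σ : Type*} [DecidableEq σ] (A : Finset σ) (j : ℕ) :
    MvPolynomial σ ℂ :=
  ∑ m ∈ A.sym j, ((m : Multiset σ).map X).prod

/-- `h_k(X−Y) := Σ_{j=0}^{k} (−1)^j e_j(Y) h_{k−j}(X)`. -/
noncomputable def hdiff {σ : Type*} [DecidableEq σ] (A B : Finset σ) (k : ℕ) :
    MvPolynomial σ ℂ :=
  ∑ j ∈ Finset.range (k + 1), (-1 : MvPolynomial σ ℂ) ^ j * esymmF B j * hsymmF A (k - j)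

/-- `h_n(X−Y)` for an integer index `n`, vanishing for `n < 0`. -/
noncomputable def hdiffZ {σ : Type*} [DecidableEq σ] (A B : Finset σ) (n : ℤ) :
    MvPolynomial σ ℂ :=
  if 0 ≤ n then hdiff A B n.toNat else 0

/-- `S_λ(X−Y) := det( h_{λ_i−i+j}(X−Y) )`. -/
noncomputable def SchurDiff {σ : Type*} [DecidableEq σ] (A B : Finset σ) {m : ℕ}
    (lam : Fin m → ℕ) : MvPolynomial σ ℂ :=
  (Matrix.of fun i j : Fin m => hdiffZ A B ((lam i : ℤ) - (i : ℤ) + (j : ℤ))).det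

/-- The ordinary Schur polynomial `S_λ(X) = S_λ(X − ∅)`. -/
noncomputable def SchurP {σ : Type*} [DecidableEq σ] (A : Finset σ) {m : ℕ}
    (lam : Fin m → ℕ) : MvPolynomial σ ℂ :=
  SchurDiff A ∅ lam

/-- The generating series `∑ (-1)^j e_j(A) T^j`. -/
noncomputable def esymmSeries {σ : Type*} [DecidableEq σ] (A : Finset σ) :
    PowerSeries (MvPolynomial σ ℂ) :=
  PowerSeries.mk fun j => (-1) ^ j * esymmF A j

/-- The generating series `∑ h_j(A) T^j`. -/
noncomputable def hsymmSeries {σ : Type*} [DecidableEq σ] (A : Finset σ) :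
    PowerSeries (MvPolynomial σ ℂ) :=
  PowerSeries.mk (hsymmF A)

section Series

variable {σ : Type*} [DecidableEq σ]

theorem esymmF_zero (A : Finset σ) : esymmF A 0 = 1 := by
  simp [esymmF]

theorem hsymmF_zero (A : Finset σ) : hsymmF A 0 = 1 := by
  rw [hsymmF, Finset.sym_zero, Finset.sum_singleton]
  rfl

theorem esymmF_insert_succ {a : σ} {A : Finset σ} (ha : a ∉ A) (k : ℕ) :
    esymmF (insert a A) (k + 1) = esymmF A (k + 1) + X a * esymmF A k := by
  unfold esymmF
  rw [Finset.powersetCard_succ_insert ha, Finset.sum_union, Finset.sum_image, Finset.mul_sum]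
  · congr 1
    refine Finset.sum_congr rfl fun s hs => ?_
    rw [Finset.prod_insert fun h => ha ((Finset.mem_powersetCard.1 hs).1 h)]
  · intro s hs t ht h
    have hs' : a ∉ s := fun h => ha ((Finset.mem_powersetCard.1 hs).1 h)
    have ht' : a ∉ t := fun h => ha ((Finset.mem_powersetCard.1 ht).1 h)
    rw [← Finset.erase_insert hs', ← Finset.erase_insert ht', h]
  · rw [Finset.disjoint_left]
    intro s hs hs'
    obtain ⟨t, -, rfl⟩ := Finset.mem_image.1 hs'
    exact ha ((Finset.mem_powersetCard.1 hs).1 (Finset.mem_insert_self a t))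

theorem hsymmF_insert_succ {a : σ} {A : Finset σ} (ha : a ∉ A) (k : ℕ) :
    hsymmF (insert a A) (k + 1) = hsymmF A (k + 1) + X a * hsymmF (insert a A) k := by
  have key : (insert a A).sym (k + 1) =
      A.sym (k + 1) ∪ ((insert a A).sym k).image (Sym.cons a) := by
    ext s
    simp only [Finset.mem_union, Finset.mem_image, Finset.mem_sym_iff, Finset.mem_insert]
    constructor
    · intro h
      by_cases has : a ∈ s
      · obtain ⟨t, rfl⟩ := Sym.exists_cons_of_mem has
        exact Or.inr ⟨t, fun b hb => h b (Sym.mem_cons_of_mem hb), rfl⟩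
      · exact Or.inl fun b hb => (h b hb).resolve_left fun e => has (e ▸ hb)
    · rintro (h | ⟨t, ht, rfl⟩) b hb
      · exact Or.inr (h b hb)
      · rcases Sym.mem_cons.1 hb with rfl | hb
        · exact Or.inl rfl
        · exact ht b hb
  unfold hsymmF
  rw [key, Finset.sum_union, Finset.sum_image, Finset.mul_sum]
  · simp only [Sym.coe_cons, Multiset.map_cons, Multiset.prod_cons]
  · intro s _ t _ h
    exact (Sym.cons_inj_right a s t).1 h
  · rw [Finset.disjoint_left]
    intro s hs hs'
    obtain ⟨t, -, rfl⟩ := Finset.mem_image.1 hs'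
    exact ha (Finset.mem_sym_iff.1 hs a (Sym.mem_cons_self a t))

theorem esymmSeries_insert {a : σ} {A : Finset σ} (ha : a ∉ A) :
    esymmSeries (insert a A) =
      (1 - PowerSeries.X * PowerSeries.C (X a)) * esymmSeries A := by
  ext1 n
  rw [sub_mul, one_mul, map_sub, mul_assoc]
  cases n with
  | zero => simp [esymmSeries, esymmF_zero]
  | succ n =>
    rw [PowerSeries.coeff_succ_X_mul, PowerSeries.coeff_C_mul]
    simp only [esymmSeries, PowerSeries.coeff_mk, esymmF_insert_succ ha]
    ring

theorem mul_hsymmSeries_insert {a : σ} {A : Finset σ} (ha : a ∉ A) :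
    (1 - PowerSeries.X * PowerSeries.C (X a)) * hsymmSeries (insert a A) = hsymmSeries A := by
  ext1 n
  rw [sub_mul, one_mul, map_sub, mul_assoc]
  cases n with
  | zero => simp [hsymmSeries, hsymmF_zero]
  | succ n =>
    rw [PowerSeries.coeff_succ_X_mul, PowerSeries.coeff_C_mul]
    simp only [hsymmSeries, PowerSeries.coeff_mk, hsymmF_insert_succ ha]
    ring

theorem esymmSeries_empty : esymmSeries (∅ : Finset σ) = 1 := by
  ext1 n
  cases n with
  | zero => simp [esymmSeries, esymmF_zero]
  | succ n =>
    have h : Finset.powersetCard (n + 1) (∅ : Finset σ) = ∅ :=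
      Finset.powersetCard_eq_empty.2 (by simp)
    simp [esymmSeries, esymmF, h, PowerSeries.coeff_one]

theorem hsymmSeries_empty : hsymmSeries (∅ : Finset σ) = 1 := by
  ext1 n
  cases n with
  | zero => simp [hsymmSeries, hsymmF_zero]
  | succ n => simp [hsymmSeries, hsymmF, PowerSeries.coeff_one]

theorem esymmSeries_mul_hsymmSeries (A : Finset σ) : esymmSeries A * hsymmSeries A = 1 := by
  induction A using Finset.induction_on with
  | empty => rw [esymmSeries_empty, hsymmSeries_empty, one_mul]
  | insert a A ha ih =>
    rw [esymmSeries_insert ha, mul_right_comm, mul_hsymmSeries_insert ha, mul_comm, ih]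

end Series

/-- The coefficient of a power series at an integer index, zero at negative indices. -/
noncomputable def PowerSeries.coeffInt {R : Type*} [CommRing R] (φ : PowerSeries R) (n : ℤ) : R :=
  if 0 ≤ n then PowerSeries.coeff n.toNat φ else 0

/-- The `n × n` upper triangular Toeplitz matrix of a power series. -/
noncomputable def PowerSeries.toeplitz {R : Type*} [CommRing R] (n : ℕ) (φ : PowerSeries R) :
    Matrix (Fin n) (Fin n) R :=
  Matrix.of fun i j => φ.coeffInt ((j : ℤ) - i)

section Toeplitz

variable {R : Type*} [CommRing R]

theorem PowerSeries.coeffInt_of_neg (φ : PowerSeries R) {n : ℤ} (hn : n < 0) :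
    φ.coeffInt n = 0 :=
  if_neg (not_le.2 hn)

theorem PowerSeries.coeffInt_natCast (φ : PowerSeries R) (n : ℕ) :
    φ.coeffInt n = PowerSeries.coeff n φ := by
  simp [PowerSeries.coeffInt]

theorem PowerSeries.toeplitz_mul (n : ℕ) (φ ψ : PowerSeries R) :
    PowerSeries.toeplitz n (φ * ψ) = PowerSeries.toeplitz n φ * PowerSeries.toeplitz n ψ := by
  ext a c
  simp only [PowerSeries.toeplitz, Matrix.mul_apply, Matrix.of_apply]
  rw [Fin.sum_univ_eq_sum_range
    (fun p : ℕ => φ.coeffInt ((p : ℤ) - (a : ℕ)) * ψ.coeffInt (((c : ℕ) : ℤ) - p)) n]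
  rcases lt_or_ge (c : ℕ) (a : ℕ) with h | h
  · rw [PowerSeries.coeffInt_of_neg _ (by lia)]
    refine (Finset.sum_eq_zero fun p _ => ?_).symm
    rcases lt_or_ge p (a : ℕ) with hp | hp
    · rw [PowerSeries.coeffInt_of_neg _ (by lia), zero_mul]
    · rw [PowerSeries.coeffInt_of_neg ψ (by lia), mul_zero]
  · obtain ⟨d, hd⟩ := Nat.exists_eq_add_of_le h
    rw [show (((c : ℕ) : ℤ) - (a : ℕ)) = (d : ℕ) by lia, PowerSeries.coeffInt_natCast,
      PowerSeries.coeff_mul, Finset.Nat.sum_antidiagonal_eq_sum_range_succ_mk]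
    have hc := c.isLt
    symm
    rw [← Finset.sum_subset (s₁ := (Finset.range (d + 1)).image ((a : ℕ) + ·)),
      Finset.sum_image fun x _ y _ h => Nat.add_left_cancel h]
    · refine Finset.sum_congr rfl fun k hk => ?_
      have hk' := Finset.mem_range.1 hk
      rw [show ((((a : ℕ) + k : ℕ) : ℤ) - (a : ℕ)) = (k : ℕ) by lia,
        show (((c : ℕ) : ℤ) - ((a : ℕ) + k : ℕ)) = (d - k : ℕ) by lia,
        PowerSeries.coeffInt_natCast, PowerSeries.coeffInt_natCast]
    · intro p hp
      simp only [Finset.mem_image, Finset.mem_range] at hp ⊢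
      lia
    · intro p _ hp
      simp only [Finset.mem_image, Finset.mem_range, not_exists, not_and] at hp
      rcases lt_or_ge p (a : ℕ) with hpa | hpa
      · rw [PowerSeries.coeffInt_of_neg _ (by lia), zero_mul]
      · rcases lt_or_ge (c : ℕ) p with hpc | hpc
        · rw [PowerSeries.coeffInt_of_neg ψ (by lia), mul_zero]
        · exact absurd (by lia) (hp (p - a) (by lia))

theorem PowerSeries.toeplitz_one (n : ℕ) : PowerSeries.toeplitz n (1 : PowerSeries R) = 1 := by
  ext i j
  rw [Matrix.one_apply]
  simp only [PowerSeries.toeplitz, Matrix.of_apply, PowerSeries.coeffInt, PowerSeries.coeff_one]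
  have hij : i = j ↔ (i : ℕ) = j := Fin.ext_iff
  split_ifs <;> first | rfl | lia

theorem PowerSeries.det_toeplitz (n : ℕ) (φ : PowerSeries R) :
    (PowerSeries.toeplitz n φ).det = PowerSeries.coeff 0 φ ^ n := by
  rw [Matrix.det_of_isUpperTriangular]
  · simp [PowerSeries.toeplitz, PowerSeries.coeffInt]
  · intro i j hij
    have hij' : (j : ℕ) < i := hij
    exact PowerSeries.coeffInt_of_neg _ (by lia)

end Toeplitz

theorem hdiffZ_eq_coeffInt {σ : Type*} [DecidableEq σ] (A B : Finset σ) (n : ℤ) :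
    hdiffZ A B n = (esymmSeries B * hsymmSeries A).coeffInt n := by
  unfold hdiffZ PowerSeries.coeffInt
  split_ifs
  · rw [PowerSeries.coeff_mul, Finset.Nat.sum_antidiagonal_eq_sum_range_succ_mk]
    simp [hdiff, esymmSeries, hsymmSeries]
  · rfl

section Box

variable {l m : ℕ}

/-- The length of the `j`-th column of a partition in the `l × m` box. -/
def colLen (f : Fin l → Fin (m + 1)) (j : Fin m) : ℕ :=
  (Finset.univ.filter fun i : Fin l => (j : ℕ) < (f i : ℕ)).card

theorem colLen_le (f : Fin l → Fin (m + 1)) (j : Fin m) : colLen f j ≤ l := by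
  simpa only [Finset.card_univ, Fintype.card_fin, colLen] using
    Finset.card_filter_le (Finset.univ : Finset (Fin l)) fun i => (j : ℕ) < (f i : ℕ)

theorem colLen_antitone (f : Fin l → Fin (m + 1)) : Antitone (colLen f) := by
  intro j k hjk
  have hjk' : (j : ℕ) ≤ k := hjk
  exact Finset.card_le_card fun i => by
    simp only [Finset.mem_filter, Finset.mem_univ, true_and]
    lia

theorem lt_colLen_iff {f : Fin l → Fin (m + 1)} (hf : Antitone f) (i : Fin l) (j : Fin m) :
    (i : ℕ) < colLen f j ↔ (j : ℕ) < f i := by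
  constructor
  · intro h
    by_contra hj
    refine absurd h (not_lt.2 ?_)
    rw [← Fin.card_Iio i]
    refine Finset.card_le_card fun k hk => ?_
    rw [Finset.mem_Iio]
    by_contra hik
    have hfk : (f k : ℕ) ≤ f i := hf (not_lt.1 hik)
    have := (Finset.mem_filter.1 hk).2
    lia
  · intro h
    rw [← Nat.succ_le_iff, Nat.succ_eq_add_one, ← Fin.card_Iic i]
    refine Finset.card_le_card fun k hk => ?_
    have hfk : (f i : ℕ) ≤ f k := hf (Finset.mem_Iic.1 hk)
    simp only [Finset.mem_filter, Finset.mem_univ, true_and]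
    lia

/-- The positions of the vertical steps of the boundary path of a partition in the box. -/
def rowPos (f : Fin l → Fin (m + 1)) (i : Fin l) : Fin (l + m) :=
  ⟨i + f i.rev, by lia⟩

/-- The positions of the horizontal steps of the boundary path of a partition in the box. -/
def colPos (f : Fin l → Fin (m + 1)) (j : Fin m) : Fin (l + m) :=
  ⟨l + j - colLen f j, by lia⟩

theorem rowPos_strictMono {f : Fin l → Fin (m + 1)} (hf : Antitone f) :
    StrictMono (rowPos f) := by
  intro i k hik
  have h : (f i.rev : ℕ) ≤ f k.rev := hf (Fin.rev_le_rev.2 hik.le)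
  have hik' : (i : ℕ) < k := hik
  change (i : ℕ) + f i.rev < k + f k.rev
  lia

theorem colPos_strictMono (f : Fin l → Fin (m + 1)) : StrictMono (colPos f) := by
  intro j k hjk
  have h := colLen_antitone f hjk.le
  have h' := colLen_le f j
  have hjk' : (j : ℕ) < k := hjk
  change l + (j : ℕ) - colLen f j < l + k - colLen f k
  lia

theorem colPos_lt_rowPos_iff {f : Fin l → Fin (m + 1)} (hf : Antitone f) (i : Fin l)
    (j : Fin m) : colPos f j < rowPos f i ↔ (j : ℕ) < f i.rev := by
  have h := lt_colLen_iff hf i.rev j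
  have h' := colLen_le f j
  rw [Fin.val_rev] at h
  change l + (j : ℕ) - colLen f j < i + f i.rev ↔ _
  lia

theorem rowPos_lt_colPos_iff {f : Fin l → Fin (m + 1)} (hf : Antitone f) (i : Fin l)
    (j : Fin m) : rowPos f i < colPos f j ↔ ¬ (j : ℕ) < f i.rev := by
  have h := lt_colLen_iff hf i.rev j
  have h' := colLen_le f j
  rw [Fin.val_rev] at h
  change (i : ℕ) + f i.rev < l + (j : ℕ) - colLen f j ↔ _
  lia

theorem rowPos_ne_colPos {f : Fin l → Fin (m + 1)} (hf : Antitone f) (i : Fin l)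
    (j : Fin m) : rowPos f i ≠ colPos f j := by
  intro h
  have h₁ := colPos_lt_rowPos_iff hf i j
  have h₂ := rowPos_lt_colPos_iff hf i j
  rw [h] at h₁ h₂
  simp only [lt_irrefl] at h₁ h₂
  tauto

theorem shuffle_injective {f : Fin l → Fin (m + 1)} (hf : Antitone f) :
    Function.Injective (Fin.append (rowPos f) (colPos f)) := by
  intro a b
  refine Fin.addCases (fun i => ?_) (fun j => ?_) a <;>
    refine Fin.addCases (fun i' => ?_) (fun j' => ?_) b <;>
    simp only [Fin.append_left, Fin.append_right] <;> intro h
  · rw [(rowPos_strictMono hf).injective h]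
  · exact absurd h (rowPos_ne_colPos hf _ _)
  · exact absurd h.symm (rowPos_ne_colPos hf _ _)
  · rw [(colPos_strictMono f).injective h]

/-- The shuffle permutation attached to a partition in the `l × m` box. -/
noncomputable def shuffle (f : Fin l → Fin (m + 1)) (hf : Antitone f) :
    Equiv.Perm (Fin (l + m)) :=
  Equiv.ofBijective _ (Finite.injective_iff_bijective.1 (shuffle_injective hf))

theorem shuffle_castAdd (f : Fin l → Fin (m + 1)) (hf : Antitone f) (i : Fin l) :
    shuffle f hf (Fin.castAdd m i) = rowPos f i := by
  simp [shuffle]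

theorem shuffle_natAdd (f : Fin l → Fin (m + 1)) (hf : Antitone f) (j : Fin m) :
    shuffle f hf (Fin.natAdd l j) = colPos f j := by
  simp [shuffle]

theorem sign_shuffle (f : Fin l → Fin (m + 1)) (hf : Antitone f) :
    (shuffle f hf).sign = (-1) ^ ∑ i, (f i : ℕ) := by
  have hrow (i : Fin l) :
      (∏ j : Fin m, if (j : ℕ) < f i.rev then (-1 : ℤˣ) else 1) = (-1) ^ (f i.rev : ℕ) := by
    rw [Finset.prod_ite, Finset.prod_const, Finset.prod_const_one, mul_one]
    congr 1
    have := (f i.rev).isLt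
    rw [Fin.card_filter_val_lt]
    lia
  have hrr (i k : Fin l) (h : i < k) : rowPos f i < rowPos f k := rowPos_strictMono hf h
  have hcc (i k : Fin m) (h : i < k) : colPos f i < colPos f k := colPos_strictMono f h
  have hlt (i : Fin l) (j : Fin m) : Fin.castAdd m i < Fin.natAdd l j := by
    simp only [Fin.lt_def, Fin.val_castAdd, Fin.val_natAdd]
    lia
  rw [Equiv.Perm.sign_eq_prod_prod_Ioi]
  have hI (a : Fin (l + m)) : Finset.Ioi a = Finset.univ.filter (a < ·) := by
    ext; simp
  simp only [hI, Finset.prod_filter, Fin.prod_univ_add, shuffle_castAdd, shuffle_natAdd]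
  have e₁ (i k : Fin l) : (if Fin.castAdd m i < Fin.castAdd m k then
      (if rowPos f i < rowPos f k then (1 : ℤˣ) else -1) else 1) = 1 := by
    split_ifs with h h' <;> first | rfl | exact absurd (hrr i k h) h'
  have e₂ (i k : Fin m) : (if Fin.natAdd l i < Fin.natAdd l k then
      (if colPos f i < colPos f k then (1 : ℤˣ) else -1) else 1) = 1 := by
    split_ifs with h h' <;>
      first | rfl | exact absurd (hcc i k ((Fin.natAdd_lt_natAdd_iff l).1 h)) h'
  have e₃ (i : Fin l) (j : Fin m) : (if Fin.castAdd m i < Fin.natAdd l j then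
      (if rowPos f i < colPos f j then (1 : ℤˣ) else -1) else 1) =
      if (j : ℕ) < f i.rev then (-1 : ℤˣ) else 1 := by
    simp only [if_pos (hlt i j), rowPos_lt_colPos_iff hf, ite_not]
  have e₄ (i : Fin l) (j : Fin m) (x : ℤˣ) :
      (if Fin.natAdd l j < Fin.castAdd m i then x else 1) = 1 :=
    if_neg (hlt i j).asymm
  simp only [e₁, e₂, e₃, e₄, Finset.prod_const_one, one_mul, mul_one, hrow]
  rw [Finset.prod_pow_eq_pow_sum, ← Equiv.sum_comp Fin.revPerm (fun i => (f i : ℕ))]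
  rfl

/-- The block permutation of `Fin (l + m)` acting by `α` on the first `l` indices and by `β` on
the last `m`. -/
def blockPerm (α : Equiv.Perm (Fin l)) (β : Equiv.Perm (Fin m)) : Equiv.Perm (Fin (l + m)) :=
  finSumFinEquiv.permCongr (Equiv.Perm.sumCongr α β)

theorem blockPerm_castAdd (α : Equiv.Perm (Fin l)) (β : Equiv.Perm (Fin m)) (i : Fin l) :
    blockPerm α β (Fin.castAdd m i) = Fin.castAdd m (α i) := by
  simp [blockPerm, Equiv.permCongr_apply]

theorem blockPerm_natAdd (α : Equiv.Perm (Fin l)) (β : Equiv.Perm (Fin m)) (j : Fin m) :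
    blockPerm α β (Fin.natAdd l j) = Fin.natAdd l (β j) := by
  simp [blockPerm, Equiv.permCongr_apply]

theorem sign_blockPerm (α : Equiv.Perm (Fin l)) (β : Equiv.Perm (Fin m)) :
    (blockPerm α β).sign = α.sign * β.sign := by
  rw [blockPerm, Equiv.Perm.sign_permCongr, Equiv.Perm.sign_sumCongr]

theorem exists_rowPos_eq {s : Fin l → Fin (l + m)} (hs : StrictMono s) :
    ∃ f : Fin l → Fin (m + 1), Antitone f ∧ rowPos f = s := by
  have hgap (i k : Fin l) (h : i ≤ k) : (s i : ℕ) + (k - i : ℕ) ≤ s k := by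
    obtain ⟨d, hd⟩ := Nat.exists_eq_add_of_le (Fin.le_def.1 h)
    induction d generalizing k with
    | zero =>
      have : i = k := Fin.ext (by lia)
      subst this
      lia
    | succ d ih =>
      have hk := k.isLt
      have h₁ := ih ⟨i + d, by lia⟩ (Fin.le_def.2 (by simp)) rfl
      have h₂ : (s ⟨i + d, by lia⟩ : ℕ) < s k := hs (Fin.lt_def.2 (by simp only; lia))
      simp only at h₁
      lia
  have hlow (i : Fin l) : (i : ℕ) ≤ s i := by
    have hi := i.isLt
    have := hgap ⟨0, by lia⟩ i (Fin.le_def.2 (by simp))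
    simp only at this
    lia
  have hupp (i : Fin l) : (s i : ℕ) ≤ i + m := by
    have hi := i.isLt
    have := hgap i ⟨l - 1, by lia⟩ (Fin.le_def.2 (by simp only; lia))
    have h' := (s ⟨l - 1, by lia⟩).isLt
    simp only at this
    lia
  refine ⟨fun i => ⟨s i.rev - i.rev, by have := hupp i.rev; lia⟩, fun i k hik => ?_, ?_⟩
  · have h₁ := hgap k.rev i.rev (Fin.rev_le_rev.2 hik)
    have h₂ : (k.rev : ℕ) ≤ i.rev := Fin.rev_le_rev.2 hik
    have h₃ := hlow k.rev
    rw [Fin.le_def]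
    simp only
    lia
  · funext i
    have := hlow i
    apply Fin.ext
    simp only [rowPos, Fin.rev_rev]
    lia

theorem shuffle_mul_blockPerm_bijective :
    Function.Bijective fun x : {f : Fin l → Fin (m + 1) // Antitone f} ×
      Equiv.Perm (Fin l) × Equiv.Perm (Fin m) =>
        shuffle x.1.1 x.1.2 * blockPerm x.2.1 x.2.2 := by
  constructor
  · rintro ⟨⟨f, hf⟩, α, β⟩ ⟨⟨g, hg⟩, α', β'⟩ h
    have hl (i : Fin l) : rowPos f (α i) = rowPos g (α' i) := by
      simpa [blockPerm_castAdd, shuffle_castAdd] using Equiv.congr_fun h (Fin.castAdd m i)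
    have hrange : Set.range (rowPos f) = Set.range (rowPos g) := by
      rw [← α.surjective.range_comp (rowPos f), ← α'.surjective.range_comp (rowPos g)]
      exact congrArg Set.range (funext hl)
    have hfg : f = g := by
      have := (StrictMono.range_inj (rowPos_strictMono hf) (rowPos_strictMono hg)).1 hrange
      funext i
      have h' := congrArg Fin.val (congrFun this i.rev)
      simp only [rowPos, Fin.rev_rev] at h'
      exact Fin.ext (by lia)
    subst hfg
    have h' := mul_left_cancel h
    have hα : α = α' := Equiv.ext fun i => by
      simpa [blockPerm_castAdd] using Equiv.congr_fun h' (Fin.castAdd m i)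
    have hβ : β = β' := Equiv.ext fun i => by
      simpa [blockPerm_natAdd] using Equiv.congr_fun h' (Fin.natAdd l i)
    rw [hα, hβ]
  · intro τ
    let S : Finset (Fin (l + m)) := Finset.univ.image fun i : Fin l => τ (Fin.castAdd m i)
    have hS : S.card = l := by
      exact (Finset.card_image_of_injective _
        (τ.injective.comp (Fin.castAdd_injective l m))).trans (Finset.card_fin l)
    obtain ⟨f, hf, hfs⟩ := exists_rowPos_eq (S.orderEmbOfFin hS).strictMono
    let ρ := (shuffle f hf)⁻¹ * τ
    have hρ (i : Fin l) : ∃ k : Fin l, ρ (Fin.castAdd m i) = Fin.castAdd m k := by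
      have hmem : τ (Fin.castAdd m i) ∈ Set.range (S.orderEmbOfFin hS) := by
        rw [Finset.range_orderEmbOfFin]
        exact Finset.mem_coe.2 (Finset.mem_image_of_mem _ (Finset.mem_univ i))
      obtain ⟨k, hk⟩ := hmem
      refine ⟨k, ?_⟩
      rw [Equiv.Perm.mul_apply, Equiv.Perm.inv_eq_iff_eq, shuffle_castAdd, hfs, hk]
    obtain ⟨⟨α, β⟩, hαβ⟩ := Equiv.Perm.mem_sumCongrHom_range_of_perm_mapsTo_inl
      (σ := finSumFinEquiv.symm.permCongr ρ) (by
        rintro _ ⟨i, rfl⟩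
        obtain ⟨k, hk⟩ := hρ i
        exact ⟨k, by simp [Equiv.permCongr_apply, hk]⟩)
    refine ⟨⟨⟨f, hf⟩, α, β⟩, ?_⟩
    have hb : blockPerm α β = ρ := by
      have hαβ' : Equiv.Perm.sumCongr α β = finSumFinEquiv.symm.permCongr ρ := hαβ
      rw [blockPerm, hαβ']
      ext a
      simp [Equiv.permCongr_apply]
    simp only [hb, ρ, mul_inv_cancel_left]

/-- Laplace expansion of a determinant along its first `l` columns. -/
theorem Matrix.det_eq_sum_antitone {R : Type*} [CommRing R]
    (M : Matrix (Fin (l + m)) (Fin (l + m)) R) :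
    M.det = ∑ f : {f : Fin l → Fin (m + 1) // Antitone f},
      (-1 : R) ^ (∑ i, (f.1 i : ℕ)) *
        (M.submatrix (colPos f.1) (Fin.natAdd l)).det *
        (M.submatrix (rowPos f.1) (Fin.castAdd m)).det := by
  rw [Matrix.det_apply', ← shuffle_mul_blockPerm_bijective.sum_comp, Fintype.sum_prod_type]
  refine Finset.sum_congr rfl fun f _ => ?_
  rw [Fintype.sum_prod_type, mul_assoc, mul_comm (Matrix.det _), Matrix.det_apply',
    Matrix.det_apply', Finset.sum_mul_sum, Finset.mul_sum]
  refine Finset.sum_congr rfl fun α _ => ?_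
  rw [Finset.mul_sum]
  refine Finset.sum_congr rfl fun β _ => ?_
  simp only [Equiv.Perm.sign_mul, sign_shuffle, sign_blockPerm, Fin.prod_univ_add,
    Equiv.Perm.mul_apply, blockPerm_castAdd, blockPerm_natAdd, shuffle_castAdd, shuffle_natAdd,
    Matrix.submatrix_apply]
  push_cast
  ring

end Box

/-- The matrix whose first `l` columns are the last `l` columns of the Toeplitz matrix of `φ`, and
whose last `m` columns are the last `m` columns of the Toeplitz matrix of `ψ`. -/
noncomputable def PowerSeries.toeplitzPair {R : Type*} [CommRing R] (l m : ℕ)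
    (φ ψ : PowerSeries R) : Matrix (Fin (l + m)) (Fin (l + m)) R :=
  Matrix.of fun p => Fin.append
    (fun j : Fin l => φ.toeplitz (l + m) p ((Fin.natAdd m j).cast (add_comm m l)))
    (fun j : Fin m => ψ.toeplitz (l + m) p (Fin.natAdd l j))

theorem PowerSeries.toeplitz_mul_toeplitzPair {R : Type*} [CommRing R] (l m : ℕ)
    (θ φ ψ : PowerSeries R) :
    θ.toeplitz (l + m) * PowerSeries.toeplitzPair l m φ ψ =
      PowerSeries.toeplitzPair l m (θ * φ) (θ * ψ) := by
  ext p q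
  refine Fin.addCases (fun j => ?_) (fun j => ?_) q <;>
    simp [PowerSeries.toeplitzPair, PowerSeries.toeplitz_mul, Matrix.mul_apply]

theorem PowerSeries.det_toeplitzPair_one {R : Type*} [CommRing R] (l m : ℕ)
    (φ : PowerSeries R) :
    (PowerSeries.toeplitzPair l m φ 1).det =
      (Matrix.of fun i j : Fin l => φ.coeffInt ((m : ℤ) - i + j)).det := by
  rw [← Matrix.det_submatrix_equiv_self finSumFinEquiv, ← Matrix.fromBlocks_toBlocks
    ((PowerSeries.toeplitzPair l m φ 1).submatrix finSumFinEquiv finSumFinEquiv)]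
  have h₁₂ : ((PowerSeries.toeplitzPair l m φ 1).submatrix
      finSumFinEquiv finSumFinEquiv).toBlocks₁₂ = 0 := by
    ext i j
    have : Fin.castAdd m i ≠ Fin.natAdd l j := by
      simp only [ne_eq, Fin.ext_iff, Fin.val_castAdd, Fin.val_natAdd]
      lia
    simp [Matrix.toBlocks₁₂, PowerSeries.toeplitzPair, PowerSeries.toeplitz_one,
      Matrix.one_apply, this]
  have h₂₂ : ((PowerSeries.toeplitzPair l m φ 1).submatrix
      finSumFinEquiv finSumFinEquiv).toBlocks₂₂ = 1 := by
    ext i j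
    simp [Matrix.toBlocks₂₂, PowerSeries.toeplitzPair, PowerSeries.toeplitz_one,
      Matrix.one_apply]
  rw [h₁₂, h₂₂, Matrix.det_fromBlocks_zero₁₂, Matrix.det_one, mul_one]
  congr 1
  ext i j
  simp only [Matrix.toBlocks₁₁, PowerSeries.toeplitzPair, PowerSeries.toeplitz,
    Matrix.submatrix_apply, Matrix.of_apply, finSumFinEquiv_apply_left, Fin.append_left,
    Fin.val_cast, Fin.val_natAdd, Fin.val_castAdd]
  congr 1
  push_cast
  ring

theorem schur_rectangle_expansion {σ : Type*} [DecidableEq σ] (Es Xs : Finset σ)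
    (hEX : Disjoint Es Xs) (l m : ℕ) (hl : 1 ≤ l) (hm : 1 ≤ m) :
    SchurDiff Es Xs (fun _ : Fin l => m) =
      ∑ f ∈ Finset.univ.filter
          (fun f : Fin l → Fin (m + 1) => ∀ i j : Fin l, i ≤ j → (f j : ℕ) ≤ (f i : ℕ)),
        (-1 : MvPolynomial σ ℂ) ^ (∑ i : Fin l, (f i : ℕ)) *
          SchurP Xs (fun jj : Fin m =>
            (Finset.univ.filter fun i : Fin l => (jj : ℕ) < (f i : ℕ)).card) *
          SchurP Es (fun i : Fin l => m - (f (Fin.rev i) : ℕ)) := by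
  have hE : PowerSeries.coeff 0 (esymmSeries Xs) = 1 := by
    simp [esymmSeries, esymmF_zero]
  have hdet : SchurDiff Es Xs (fun _ : Fin l => m) =
      (PowerSeries.toeplitzPair l m (hsymmSeries Es) (hsymmSeries Xs)).det := by
    rw [← one_mul (Matrix.det _), ← one_pow (l + m), ← hE, ← PowerSeries.det_toeplitz,
      ← Matrix.det_mul, PowerSeries.toeplitz_mul_toeplitzPair, esymmSeries_mul_hsymmSeries,
      PowerSeries.det_toeplitzPair_one]
    simp only [SchurDiff, hdiffZ_eq_coeffInt]
  rw [hdet, Matrix.det_eq_sum_antitone]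
  symm
  refine Finset.sum_subtype _ (fun f => ?_) _ |>.trans (Finset.sum_congr rfl fun f _ => ?_)
  · simp only [Finset.mem_filter, Finset.mem_univ, true_and]
    exact ⟨fun h i j hij => h i j hij, fun h i j hij => h hij⟩
  · congr 2
    · simp only [SchurP, SchurDiff, hdiffZ_eq_coeffInt, esymmSeries_empty, one_mul]
      congr 1
      ext1 j k
      have hle := colLen_le f.1 j
      simp only [PowerSeries.toeplitzPair, PowerSeries.toeplitz, Matrix.submatrix_apply,
        Matrix.of_apply, Fin.append_right, Fin.val_natAdd, colPos]
      change PowerSeries.coeffInt _ ((colLen f.1 j : ℤ) - j + k) = _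
      congr 1
      lia
    · simp only [SchurP, SchurDiff, hdiffZ_eq_coeffInt, esymmSeries_empty, one_mul]
      congr 1
      ext1 i j
      have hle := (f.1 i.rev).isLt
      simp only [PowerSeries.toeplitzPair, PowerSeries.toeplitz, Matrix.submatrix_apply,
        Matrix.of_apply, Fin.append_left, Fin.val_cast, Fin.val_natAdd, rowPos]
      congr 1
      lia
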